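/- The homogeneous networked system (𝒞, 𝒜), with 𝒜 = I_N ⊗ A + L ⊗ (HC) and 𝒞 = I_N ⊗ C, is observable if and only if the pair (C, A) is observable. -/

import Mathlib

open Matrix BigOperators

/-- Complexification of a real matrix (entrywise coercion `ℝ → ℂ`). -/
noncomputable def matC {m n : Type*} (M : Matrix m n ℝ) : Matrix m n ℂ :=
  M.map (fun x => (x : ℂ))

/-- PBH eigenvector test for controllability of the pair `(A, B)`:
for every `λ ∈ ℂ`, the only row vector `v` with `v A = λ v` and `v B = 0` is `v = 0`. -/
def IsControllablePair {n p : Type*} [Fintype n] [Fintype p]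
    (A : Matrix n n ℝ) (B : Matrix n p ℝ) : Prop :=
  ∀ (lam : ℂ) (v : n → ℂ), v ᵥ* matC A = lam • v → v ᵥ* matC B = 0 → v = 0

/-- PBH eigenvector test for observability of the pair `(C, A)`:
for every `λ ∈ ℂ`, the only column vector `v` with `A v = λ v` and `C v = 0` is `v = 0`. -/
def IsObservablePair {m n : Type*} [Fintype m] [Fintype n]
    (C : Matrix m n ℝ) (A : Matrix n n ℝ) : Prop :=
  ∀ (lam : ℂ) (v : n → ℂ), matC A *ᵥ v = lam • v → matC C *ᵥ v = 0 → v = 0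

/-- The set of complex eigenvalues of a real square matrix. -/
noncomputable def eigSet {n : Type*} [Fintype n] (M : Matrix n n ℝ) : Set ℂ :=
  {μ | ∃ v : n → ℂ, v ≠ 0 ∧ matC M *ᵥ v = μ • v}

/-- `v` is a left eigenvector of the real matrix `M` for the eigenvalue `μ`. -/
def IsLeftEig {n : Type*} [Fintype n] (M : Matrix n n ℝ) (μ : ℂ) (v : n → ℂ) : Prop :=
  v ≠ 0 ∧ v ᵥ* matC M = μ • v

/-- The networked state matrix `𝒜`: the block matrix whose `(i,j)` block is
`A i + β i i • (H i * C i)` when `j = i` and `β i j • (H i * C j)` when `j ≠ i`. -/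
noncomputable def netA (N : ℕ) (n : Fin N → ℕ) (m : ℕ)
    (A : ∀ i, Matrix (Fin (n i)) (Fin (n i)) ℝ)
    (H : ∀ i, Matrix (Fin (n i)) (Fin m) ℝ)
    (C : ∀ i, Matrix (Fin m) (Fin (n i)) ℝ)
    (β : Fin N → Fin N → ℝ) :
    Matrix (Σ i, Fin (n i)) (Σ i, Fin (n i)) ℝ :=
  Matrix.blockDiagonal' A +
    Matrix.of (fun x y => β x.1 y.1 * (H x.1 * C y.1) x.2 y.2)

/-- The networked input matrix `ℬ = blockdiag(δ₁B₁, …, δ_N B_N)`. -/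
noncomputable def netB (N : ℕ) (n p : Fin N → ℕ)
    (B : ∀ i, Matrix (Fin (n i)) (Fin (p i)) ℝ) (δ : Fin N → ℝ) :
    Matrix (Σ i, Fin (n i)) (Σ i, Fin (p i)) ℝ :=
  Matrix.blockDiagonal' (fun i => δ i • B i)

/-- The networked output matrix `𝒞 = blockdiag(C₁, …, C_N)`. -/
noncomputable def netC (N : ℕ) (n : Fin N → ℕ) (m : ℕ)
    (C : ∀ i, Matrix (Fin m) (Fin (n i)) ℝ) :
    Matrix (Σ _ : Fin N, Fin m) (Σ i, Fin (n i)) ℝ :=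
  Matrix.blockDiagonal' C

/-- The row vector `[0, …, 0, ζ, 0, …, 0]` with block `ζ` in position `i`. -/
def padded {N : ℕ} (n : Fin N → ℕ) (i : Fin N) (ζ : Fin (n i) → ℂ) :
    (Σ j, Fin (n j)) → ℂ :=
  fun x => if h : x.1 = i then ζ (Fin.cast (congrArg n h) x.2) else 0

section

open scoped Kronecker

theorem matC_add {m n : Type*} (M M' : Matrix m n ℝ) : matC (M + M') = matC M + matC M' := by
  ext; simp [matC]

theorem matC_mul {l m n : Type*} [Fintype m] (M : Matrix l m ℝ) (M' : Matrix m n ℝ) :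
    matC (M * M') = matC M * matC M' := by
  ext; simp [matC, Matrix.mul_apply]

/-- Observability is invariant under output injection. -/
theorem isObservablePair_add_mul_iff {m n : Type*} [Fintype m] [Fintype n]
    (C : Matrix m n ℝ) (A : Matrix n n ℝ) (K : Matrix n m ℝ) :
    IsObservablePair C (A + K * C) ↔ IsObservablePair C A := by
  have key (v : n → ℂ) (hv : matC C *ᵥ v = 0) : matC (A + K * C) *ᵥ v = matC A *ᵥ v := by
    rw [matC_add, matC_mul, add_mulVec, ← mulVec_mulVec, hv, mulVec_zero, add_zero]
  exact forall₂_congr fun lam v =>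
    ⟨fun h hA hC => h ((key v hC).trans hA) hC, fun h hA hC => h ((key v hC).symm.trans hA) hC⟩

theorem matC_one_kronecker_mulVec_apply {ι m n : Type*} [Fintype ι] [DecidableEq ι] [Fintype n]
    (M : Matrix m n ℝ) (v : ι × n → ℂ) (i : ι) (a : m) :
    (matC ((1 : Matrix ι ι ℝ) ⊗ₖ M) *ᵥ v) (i, a) = (matC M *ᵥ fun b => v (i, b)) a := by
  simp only [mulVec, dotProduct, matC, map_apply, kroneckerMap_apply, Fintype.sum_prod_type,
    one_apply]
  rw [Finset.sum_eq_single i]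
  · simp
  · intro j _ hj
    simp [hj.symm]
  · simp

/-- A nonempty family of identical uncoupled systems is observable iff the single system is. -/
theorem isObservablePair_one_kronecker_iff {ι m n : Type*} [Fintype ι] [DecidableEq ι] [Nonempty ι]
    [Fintype m] [Fintype n] (C : Matrix m n ℝ) (A : Matrix n n ℝ) :
    IsObservablePair ((1 : Matrix ι ι ℝ) ⊗ₖ C) ((1 : Matrix ι ι ℝ) ⊗ₖ A) ↔
      IsObservablePair C A := by
  refine ⟨fun h lam v hA hC => ?_, fun h lam v hA hC => ?_⟩
  · have hv : (fun x : ι × n => v x.2) = 0 := by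
      refine h lam _ ?_ ?_
      · ext ⟨i, a⟩
        rw [matC_one_kronecker_mulVec_apply]
        exact congrFun hA a
      · ext ⟨i, a⟩
        rw [matC_one_kronecker_mulVec_apply]
        exact congrFun hC a
    ext a
    exact congrFun hv (Classical.arbitrary ι, a)
  · ext ⟨i, a⟩
    refine congrFun (h lam (fun b => v (i, b)) ?_ ?_) a
    · ext b
      rw [← matC_one_kronecker_mulVec_apply]
      exact congrFun hA (i, b)
    · ext b
      rw [← matC_one_kronecker_mulVec_apply]
      exact congrFun hC (i, b)

end

open scoped Kronecker in
theorem homogeneous_observability_iff_node_observability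
    (N n m : ℕ) (hN : 0 < N)
    (A : Matrix (Fin n) (Fin n) ℝ) (C : Matrix (Fin m) (Fin n) ℝ)
    (H : Matrix (Fin n) (Fin m) ℝ)
    (L : Matrix (Fin N) (Fin N) ℝ) :
    IsObservablePair
        ((1 : Matrix (Fin N) (Fin N) ℝ) ⊗ₖ C)
        ((1 : Matrix (Fin N) (Fin N) ℝ) ⊗ₖ A + L ⊗ₖ (H * C)) ↔
      IsObservablePair C A := by
  have : Nonempty (Fin N) := ⟨⟨0, hN⟩⟩
  have hLHC : L ⊗ₖ (H * C) = (L ⊗ₖ H) * ((1 : Matrix (Fin N) (Fin N) ℝ) ⊗ₖ C) := by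
    rw [← mul_kronecker_mul, Matrix.mul_one]
  rw [hLHC, isObservablePair_add_mul_iff, isObservablePair_one_kronecker_iff]
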